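/- There exists a constant C > 0 such that for all integers n ≥ 2, |Σ_{2 < p ≤ 2n, p prime} log p/(p−1) − log n + γ| ≤ C/(log n), where γ is the Euler–Mascheroni constant. -/

import Mathlib

section

open Complex Filter Topology

/-- The `n`-th correction term in the Euler–Maclaurin expansion of `(s - 1) ζ(s)`. -/
noncomputable def zetaTerm (n : ℕ) (s : ℂ) : ℂ :=
  (s - 1) * ((n : ℂ) + 1) ^ (-s) + ((n : ℂ) + 1) ^ (1 - s) - (n : ℂ) ^ (1 - s)

lemma norm_cpow_neg_sub_le {n : ℕ} (hn : 1 ≤ n) {s : ℂ} (hs : 0 < s.re) {x : ℝ}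
    (hx : x ∈ Set.Icc (n : ℝ) (n + 1)) :
    ‖((n : ℂ) + 1) ^ (-s) - (x : ℂ) ^ (-s)‖ ≤ ‖s‖ * (n : ℝ) ^ (-s.re - 1) := by
  have hn0 : (0 : ℝ) < n := by exact_mod_cast hn
  have key := (convex_Icc (n : ℝ) (n + 1)).norm_image_sub_le_of_norm_hasDerivWithin_le
    (f := fun y : ℝ => (y : ℂ) ^ (-s)) (f' := fun y : ℝ => -s * (y : ℂ) ^ (-s - 1))
    (C := ‖s‖ * (n : ℝ) ^ (-s.re - 1)) (x := x) (y := n + 1) ?_ ?_ hx ⟨by linarith, le_rfl⟩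
  · refine (le_trans (le_of_eq ?_) key).trans ?_
    · push_cast; rfl
    · rw [Real.norm_of_nonneg (by linarith [hx.2])]
      exact mul_le_of_le_one_right (by positivity) (by linarith [hx.1])
  · intro y hy
    have hy0 : 0 < y := hn0.trans_le hy.1
    have h1 : HasDerivAt (fun y : ℝ => (y : ℂ) ^ (-s)) (-s * (y : ℂ) ^ (-s - 1)) y :=
      (hasStrictDerivAt_cpow_const (x := (y : ℂ)) (c := -s)
        (by simp [slitPlane, hy0])).hasDerivAt.comp_ofReal
    exact h1.hasDerivWithinAt
  · intro y hy
    have hy0 : 0 < y := hn0.trans_le hy.1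
    rw [norm_mul, norm_neg, norm_cpow_eq_rpow_re_of_pos hy0]
    gcongr
    simp only [sub_re, neg_re, one_re]
    exact Real.rpow_le_rpow_of_nonpos hn0 hy.1 (by linarith)

lemma norm_zetaTerm_le {n : ℕ} (hn : 1 ≤ n) {s : ℂ} (hs : 0 < s.re) :
    ‖zetaTerm n s‖ ≤ ‖s - 1‖ * (‖s‖ * (n : ℝ) ^ (-s.re - 1)) := by
  have hn0 : (0 : ℝ) < n := by exact_mod_cast hn
  have key := (convex_Icc (n : ℝ) (n + 1)).norm_image_sub_le_of_norm_hasDerivWithin_le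
    (f := fun y : ℝ => (s - 1) * ((n : ℂ) + 1) ^ (-s) * y + (y : ℂ) ^ (1 - s))
    (f' := fun y : ℝ => (s - 1) * (((n : ℂ) + 1) ^ (-s) - (y : ℂ) ^ (-s)))
    (C := ‖s - 1‖ * (‖s‖ * (n : ℝ) ^ (-s.re - 1))) (x := n) (y := n + 1) ?_ ?_
    ⟨le_rfl, by linarith⟩ ⟨by linarith, le_rfl⟩
  · refine (le_trans (le_of_eq ?_) key).trans ?_
    · unfold zetaTerm; push_cast; congr 1; ring
    · simp
  · intro y hy
    have hy0 : 0 < y := hn0.trans_le hy.1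
    have h1 : HasDerivAt (fun y : ℝ => (y : ℂ) ^ (1 - s)) ((1 - s) * (y : ℂ) ^ (1 - s - 1)) y :=
      (hasStrictDerivAt_cpow_const (x := (y : ℂ)) (c := 1 - s)
        (by simp [slitPlane, hy0])).hasDerivAt.comp_ofReal
    have h2 : HasDerivAt (fun y : ℝ => (s - 1) * ((n : ℂ) + 1) ^ (-s) * y)
        ((s - 1) * ((n : ℂ) + 1) ^ (-s) * 1) y := by
      exact (ofRealCLM.hasDerivAt (x := y)).const_mul _
    refine ((h2.add h1).congr_deriv ?_).hasDerivWithinAt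
    rw [show 1 - s - 1 = -s by ring]; ring
  · intro y hy
    rw [norm_mul]
    gcongr
    exact norm_cpow_neg_sub_le hn hs hy

lemma differentiable_zetaTerm {n : ℕ} (hn : 1 ≤ n) : Differentiable ℂ (zetaTerm n) := by
  have h1 : (n : ℂ) + 1 ≠ 0 := by exact_mod_cast n.succ_ne_zero
  have h2 : (n : ℂ) ≠ 0 := by exact_mod_cast (by omega : n ≠ 0)
  unfold zetaTerm
  intro s
  have := (differentiableAt_id.neg (x := s) (𝕜 := ℂ)).const_cpow (c := (n : ℂ) + 1) (.inl h1)
  have := ((differentiableAt_id (x := s) (𝕜 := ℂ)).const_sub 1).const_cpow (c := (n : ℂ) + 1) (.inl h1)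
  have := ((differentiableAt_id (x := s) (𝕜 := ℂ)).const_sub 1).const_cpow (c := (n : ℂ)) (.inl h2)
  fun_prop (disch := assumption)

lemma summable_zetaTerm_bound {r : ℝ} (hr : 0 < r) (N : ℕ) :
    Summable fun k : ℕ => ((k + N : ℕ) : ℝ) ^ (-r - 1) :=
  (summable_nat_add_iff N).2 (Real.summable_nat_rpow.2 (by linarith))

lemma summable_zetaTerm {N : ℕ} (hN : 1 ≤ N) {s : ℂ} (hs : 0 < s.re) :
    Summable fun k : ℕ => zetaTerm (k + N) s :=
  .of_norm_bounded (((summable_zetaTerm_bound hs N).mul_left ‖s‖).mul_left ‖s - 1‖)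
    fun k => norm_zetaTerm_le (by omega) hs

lemma sum_range_zetaTerm (N K : ℕ) (s : ℂ) :
    ∑ k ∈ Finset.range K, zetaTerm (k + N) s =
      (s - 1) * ∑ k ∈ Finset.range K, ((k + N : ℕ) + 1 : ℂ) ^ (-s) +
        ((K + N : ℕ) : ℂ) ^ (1 - s) - (N : ℂ) ^ (1 - s) := by
  induction K with
  | zero => simp
  | succ K ih =>
    rw [Finset.sum_range_succ, ih, Finset.sum_range_succ, zetaTerm,
      show ((K + 1 + N : ℕ) : ℂ) = (K + N : ℕ) + 1 by push_cast; ring]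
    ring

lemma riemannZeta₁_eq_of_one_lt_re {s : ℂ} (hs : 1 < s.re) :
    riemannZeta₁ s = s + ∑' k : ℕ, zetaTerm (k + 1) s := by
  have hs1 : s ≠ 1 := by rintro rfl; simp at hs
  have hW : riemannZeta₁ s = (s - 1) * riemannZeta s := by
    rw [riemannZeta_eq_inv_sub_mul hs1]; field_simp [sub_ne_zero.2 hs1]
  have hsum : Summable fun n : ℕ => 1 / ((n : ℂ) + 1) ^ s := by
    have := (summable_nat_add_iff 1).2 (Complex.summable_one_div_nat_cpow.2 hs)
    simpa using this
  have h1 := (summable_zetaTerm le_rfl (by linarith : 0 < s.re)).hasSum.tendsto_sum_nat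
  have h2 : Tendsto (fun K : ℕ => ∑ k ∈ Finset.range K, zetaTerm (k + 1) s) atTop
      (𝓝 ((s - 1) * (riemannZeta s - 1) + 0 - 1)) := by
    simp only [sum_range_zetaTerm]
    refine Tendsto.sub (Tendsto.add (Tendsto.const_mul _ ?_) ?_) (by simp)
    · rw [zeta_eq_tsum_one_div_nat_add_one_cpow hs, hsum.tsum_eq_zero_add]
      have h3 := ((summable_nat_add_iff 1).2 hsum).hasSum.tendsto_sum_nat
      simp only [cpow_neg, ← one_div]
      simpa using h3
    · rw [tendsto_zero_iff_norm_tendsto_zero]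
      have : Tendsto (fun K : ℕ => ((K + 1 : ℕ) : ℝ) ^ (-(s.re - 1))) atTop (𝓝 0) :=
        (tendsto_rpow_neg_atTop (by linarith)).comp
          (tendsto_natCast_atTop_atTop.comp (tendsto_add_atTop_nat 1))
      refine this.congr fun K => ?_
      rw [norm_natCast_cpow_of_pos (by omega)]
      simp
  rw [hW, tendsto_nhds_unique h1 h2]
  ring

lemma riemannZeta₁_eq {s : ℂ} (hs : 0 < s.re) :
    riemannZeta₁ s = s + ∑' k : ℕ, zetaTerm (k + 1) s := by
  have hopen : IsOpen {s : ℂ | 0 < s.re} := isOpen_lt continuous_const continuous_re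
  have hdiff : DifferentiableOn ℂ (fun s => s + ∑' k : ℕ, zetaTerm (k + 1) s) {s | 0 < s.re} := by
    refine differentiableOn_id.add fun z hz => ?_
    set U : Set ℂ := {s | z.re / 2 < s.re} ∩ Metric.ball 0 (‖z‖ + 1)
    have hU : IsOpen U := (isOpen_lt continuous_const continuous_re).inter Metric.isOpen_ball
    have hz' : 0 < z.re := hz
    have hzU : z ∈ U := ⟨by simp only [Set.mem_ofPred_eq]; linarith, by simp⟩
    refine ((differentiableOn_tsum_of_summable_norm (F := fun k : ℕ => zetaTerm (k + 1))
      (u := fun k : ℕ => (‖z‖ + 2) * ((‖z‖ + 1) * ((k + 1 : ℕ) : ℝ) ^ (-(z.re / 2) - 1)))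
      (((summable_zetaTerm_bound (by linarith) 1).mul_left _).mul_left _)
      (fun k => (differentiable_zetaTerm (by omega)).differentiableOn) hU ?_).differentiableAt
        (hU.mem_nhds hzU)).differentiableWithinAt
    intro k w hw
    have hw1 : z.re / 2 < w.re := hw.1
    have hw2 : ‖w‖ < ‖z‖ + 1 := by simpa using hw.2
    refine (norm_zetaTerm_le (by omega) (by linarith)).trans ?_
    have : ‖w - 1‖ ≤ ‖z‖ + 2 := (norm_sub_le _ _).trans (by simp; linarith)
    gcongr
    · simp
  refine AnalyticOnNhd.eqOn_of_preconnected_of_eventuallyEq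
    (differentiable_riemannZeta₁.differentiableOn.analyticOnNhd hopen)
    (hdiff.analyticOnNhd hopen) (convex_halfSpace_re_gt 0).isPreconnected
    (z₀ := 2) (by simp) ?_ hs
  filter_upwards [(isOpen_lt continuous_const continuous_re).mem_nhds
    (show (1 : ℝ) < (2 : ℂ).re by simp)] with w hw using riemannZeta₁_eq_of_one_lt_re hw

lemma riemannZeta₁_eq_add_tsum {s : ℂ} (hs : 0 < s.re) (N : ℕ) :
    riemannZeta₁ s = (s - 1) * ∑ k ∈ Finset.range (N + 1), ((k : ℂ) + 1) ^ (-s) +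
      ((N + 1 : ℕ) : ℂ) ^ (1 - s) + ∑' k : ℕ, zetaTerm (k + (N + 1)) s := by
  rw [riemannZeta₁_eq hs, ← (summable_zetaTerm le_rfl hs).sum_add_tsum_nat_add N,
    sum_range_zetaTerm, Finset.sum_range_succ']
  simp only [add_assoc]
  push_cast
  simp only [one_cpow, zero_add, add_assoc]
  ring

lemma exists_norm_riemannZeta₁_le :
    ∃ C > 0, ∀ s : ℂ, 31 / 32 ≤ s.re → s.re ≤ 3 →
      ‖riemannZeta₁ s‖ ≤ C * (1 + |s.im|) ^ (17 / 16 : ℝ) := by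
  have hZ : Summable fun k : ℕ => ((k + 1 : ℕ) : ℝ) ^ (-(1 / 32 : ℝ) - 1) :=
    summable_zetaTerm_bound (by norm_num) 1
  set Z := ∑' k : ℕ, ((k + 1 : ℕ) : ℝ) ^ (-(1 / 32 : ℝ) - 1) with hZdef
  have hZ0 : 0 ≤ Z := tsum_nonneg fun k => by positivity
  refine ⟨10 * Z + 2, by positivity, fun s hs1 hs2 => ?_⟩
  set τ := 1 + |s.im| with hτ
  have hτ1 : 1 ≤ τ := by simp [hτ]
  obtain ⟨N, hN1, hN2⟩ : ∃ N : ℕ, τ ≤ (N + 1 : ℕ) ∧ ((N + 1 : ℕ) : ℝ) ≤ 2 * τ := by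
    refine ⟨⌈τ⌉₊ - 1, ?_⟩
    rw [Nat.sub_add_cancel (Nat.ceil_pos.2 (by linarith))]
    exact ⟨Nat.le_ceil _, by linarith [Nat.ceil_lt_add_one (show 0 ≤ τ by linarith)]⟩
  have hre : 0 < s.re := by linarith
  have hs1' : ‖s - 1‖ ≤ 2 * τ := by
    refine (norm_le_abs_re_add_abs_im _).trans ?_
    have : |(s - 1).re| ≤ 2 := by simp only [sub_re, one_re]; rw [abs_le]; constructor <;> linarith
    have : |(s - 1).im| = |s.im| := by simp
    linarith [abs_nonneg s.im]
  have hs' : ‖s‖ ≤ 3 * τ := by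
    refine (norm_le_abs_re_add_abs_im _).trans ?_
    rw [abs_of_pos hre]
    linarith [abs_nonneg s.im]
  have hN0 : (1 : ℝ) ≤ (N + 1 : ℕ) := hτ1.trans hN1
  have hNpow : ((N + 1 : ℕ) : ℝ) ^ (1 / 16 : ℝ) ≤ 2 * τ ^ (1 / 16 : ℝ) := by
    calc ((N + 1 : ℕ) : ℝ) ^ (1 / 16 : ℝ) ≤ (2 * τ) ^ (1 / 16 : ℝ) := by gcongr
      _ = 2 ^ (1 / 16 : ℝ) * τ ^ (1 / 16 : ℝ) := Real.mul_rpow (by norm_num) (by linarith)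
      _ ≤ 2 ^ (1 : ℝ) * τ ^ (1 / 16 : ℝ) := by gcongr <;> norm_num
      _ = _ := by simp
  have hsum : ‖∑ k ∈ Finset.range (N + 1), ((k : ℂ) + 1) ^ (-s)‖ ≤ 2 * τ ^ (1 / 16 : ℝ) * Z := by
    refine (norm_sum_le_of_le (f := fun k : ℕ => ((k : ℂ) + 1) ^ (-s))
      (n := fun k : ℕ => 2 * τ ^ (1 / 16 : ℝ) * ((k + 1 : ℕ) : ℝ) ^ (-(1 / 32 : ℝ) - 1)) _
      fun k hk => ?_).trans ?_
    · have hk0 : (0 : ℝ) < ((k + 1 : ℕ) : ℝ) := by positivity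
      have hk1 : (1 : ℝ) ≤ ((k + 1 : ℕ) : ℝ) := by exact_mod_cast k.succ_pos
      have hkN : ((k + 1 : ℕ) : ℝ) ≤ (N + 1 : ℕ) := by
        exact_mod_cast Finset.mem_range.1 hk
      rw [show (k : ℂ) + 1 = (k + 1 : ℕ) by push_cast; rfl, norm_natCast_cpow_of_pos k.succ_pos]
      calc ((k + 1 : ℕ) : ℝ) ^ (-s).re ≤ ((k + 1 : ℕ) : ℝ) ^ (1 / 16 + (-(1 / 32 : ℝ) - 1)) :=
            Real.rpow_le_rpow_of_exponent_le hk1 (by simp only [neg_re]; linarith)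
        _ = ((k + 1 : ℕ) : ℝ) ^ (1 / 16 : ℝ) * ((k + 1 : ℕ) : ℝ) ^ (-(1 / 32 : ℝ) - 1) :=
            Real.rpow_add hk0 _ _
        _ ≤ ((N + 1 : ℕ) : ℝ) ^ (1 / 16 : ℝ) * ((k + 1 : ℕ) : ℝ) ^ (-(1 / 32 : ℝ) - 1) := by gcongr
        _ ≤ _ := by gcongr
    · rw [← Finset.mul_sum]
      gcongr
      exact hZ.sum_le_tsum _ fun k _ => by positivity
  have hpow : ‖((N + 1 : ℕ) : ℂ) ^ (1 - s)‖ ≤ 2 * τ ^ (1 / 16 : ℝ) := by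
    rw [norm_natCast_cpow_of_pos N.succ_pos]
    refine le_trans (Real.rpow_le_rpow_of_exponent_le hN0 ?_) hNpow
    simp only [sub_re, one_re]; linarith
  have htail : ‖∑' k : ℕ, zetaTerm (k + (N + 1)) s‖ ≤
      2 * τ * (3 * τ * (τ ^ (-(15 / 16) : ℝ) * Z)) := by
    refine tsum_of_norm_bounded (((hZ.hasSum.mul_left _).mul_left _).mul_left _) fun k => ?_
    refine (norm_zetaTerm_le (by omega) hre).trans ?_
    have hk1 : (1 : ℝ) ≤ ((k + (N + 1) : ℕ) : ℝ) := by
      exact_mod_cast (by omega : 1 ≤ k + (N + 1))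
    have hkN : ((N + 1 : ℕ) : ℝ) ≤ ((k + (N + 1) : ℕ) : ℝ) := by
      exact_mod_cast (by omega : N + 1 ≤ k + (N + 1))
    have hk2 : ((k + 1 : ℕ) : ℝ) ≤ ((k + (N + 1) : ℕ) : ℝ) := by
      exact_mod_cast (by omega : k + 1 ≤ k + (N + 1))
    have : ((k + (N + 1) : ℕ) : ℝ) ^ (-s.re - 1) ≤
        τ ^ (-(15 / 16) : ℝ) * ((k + 1 : ℕ) : ℝ) ^ (-(1 / 32 : ℝ) - 1) :=
      calc _ ≤ ((k + (N + 1) : ℕ) : ℝ) ^ (-(15 / 16) + (-(1 / 32 : ℝ) - 1)) :=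
            Real.rpow_le_rpow_of_exponent_le hk1 (by linarith)
        _ = ((k + (N + 1) : ℕ) : ℝ) ^ (-(15 / 16) : ℝ) *
              ((k + (N + 1) : ℕ) : ℝ) ^ (-(1 / 32 : ℝ) - 1) :=
            Real.rpow_add (by linarith) _ _
        _ ≤ _ := mul_le_mul
            (Real.rpow_le_rpow_of_nonpos (by linarith) (hN1.trans hkN) (by norm_num))
            (Real.rpow_le_rpow_of_nonpos (by positivity) hk2 (by norm_num))
            (by positivity) (by positivity)
    gcongr
  have e1 : τ * τ ^ (1 / 16 : ℝ) = τ ^ (17 / 16 : ℝ) := by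
    rw [← Real.rpow_one_add' (by linarith) (by norm_num)]; norm_num
  have e2 : τ * (τ * τ ^ (-(15 / 16) : ℝ)) = τ ^ (17 / 16 : ℝ) := by
    rw [← Real.rpow_one_add' (by linarith) (by norm_num), ← Real.rpow_one_add' (by linarith) (by norm_num)]
    norm_num
  rw [riemannZeta₁_eq_add_tsum hre N]
  refine (norm_add₃_le).trans ?_
  rw [norm_mul]
  have h1 : ‖s - 1‖ * ‖∑ k ∈ Finset.range (N + 1), ((k : ℂ) + 1) ^ (-s)‖ ≤
      2 * τ * (2 * τ ^ (1 / 16 : ℝ) * Z) := by gcongr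
  have h2 : τ ^ (1 / 16 : ℝ) ≤ τ ^ (17 / 16 : ℝ) :=
    Real.rpow_le_rpow_of_exponent_le hτ1 (by norm_num)
  calc _ ≤ 2 * τ * (2 * τ ^ (1 / 16 : ℝ) * Z) + 2 * τ ^ (17 / 16 : ℝ) +
        2 * τ * (3 * τ * (τ ^ (-(15 / 16) : ℝ) * Z)) := by linarith
    _ = 4 * (τ * τ ^ (1 / 16 : ℝ)) * Z + 2 * τ ^ (17 / 16 : ℝ) +
        6 * (τ * (τ * τ ^ (-(15 / 16) : ℝ))) * Z := by ring
    _ = _ := by rw [e1, e2]; ring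

lemma two_mul_rpow_le {τ : ℝ} (hτ : 0 ≤ τ) :
    (2 * τ) ^ (17 / 16 : ℝ) ≤ 4 * τ ^ (17 / 16 : ℝ) := by
  rw [Real.mul_rpow (by norm_num) hτ]
  gcongr
  calc (2 : ℝ) ^ (17 / 16 : ℝ) ≤ 2 ^ (2 : ℝ) := by gcongr <;> norm_num
    _ = 4 := by norm_num

lemma exists_norm_iteratedDeriv_riemannZeta₁_le (j : ℕ) :
    ∃ C > 0, ∀ s : ℂ, 1 ≤ s.re → s.re ≤ 2 →
      ‖iteratedDeriv j riemannZeta₁ s‖ ≤ C * (1 + |s.im|) ^ (17 / 16 : ℝ) := by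
  obtain ⟨C, hC, h⟩ := exists_norm_riemannZeta₁_le
  refine ⟨j.factorial * (4 * C) / (1 / 32) ^ j, by positivity, fun s hs1 hs2 => ?_⟩
  have key := norm_iteratedDeriv_le_of_forall_mem_sphere_norm_le (c := s) (R := 1 / 32)
    (C := 4 * C * (1 + |s.im|) ^ (17 / 16 : ℝ)) j (by norm_num)
    differentiable_riemannZeta₁.diffContOnCl fun w hw => ?_
  · exact key.trans (le_of_eq (by ring))
  · rw [mem_sphere_iff_norm] at hw
    have hre := (abs_re_le_norm (w - s)).trans_eq hw
    have him := (abs_im_le_norm (w - s)).trans_eq hw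
    rw [sub_re, abs_le] at hre
    rw [sub_im] at him
    have him' : |w.im| ≤ |s.im| + 1 / 32 := by
      linarith [abs_sub_abs_le_abs_sub w.im s.im]
    refine (h w (by linarith) (by linarith)).trans ?_
    calc C * (1 + |w.im|) ^ (17 / 16 : ℝ) ≤ C * (2 * (1 + |s.im|)) ^ (17 / 16 : ℝ) := by
          gcongr; linarith [abs_nonneg s.im]
      _ ≤ C * (4 * (1 + |s.im|) ^ (17 / 16 : ℝ)) := by
          gcongr; exact two_mul_rpow_le (by positivity)
      _ = _ := by ring

lemma rpow_seventeen_div_sixteen {τ : ℝ} (hτ : 0 ≤ τ) :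
    τ ^ (17 / 16 : ℝ) = (τ ^ (1 / 16 : ℝ)) ^ 17 := by
  rw [← Real.rpow_mul_natCast hτ]; norm_num

lemma exists_re_sub_one_pow_mul_le :
    ∃ K > 0, ∀ s : ℂ, 1 < s.re → s.re ≤ 2 → 1 ≤ |s.im| →
      (s.re - 1) ^ 3 * ((1 + |s.im|) ^ (1 / 16 : ℝ)) ^ 63 ≤ K * ‖riemannZeta₁ s‖ ^ 4 := by
  obtain ⟨C, hC, h⟩ := exists_norm_riemannZeta₁_le
  refine ⟨64 * C ^ 4, by positivity, fun s hs1 hs2 hs3 => ?_⟩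
  have key := DirichletCharacter.norm_LFunction_product_ge_one (N := 1) (1 : DirichletCharacter ℂ 1)
    (sub_pos.2 hs1) s.im
  set τ := 1 + |s.im| with hτ
  set x := s.re - 1 with hx
  have hx0 : 0 < x := by linarith
  set X := τ ^ (1 / 16 : ℝ) with hX
  have hτ0 : 0 ≤ τ := by positivity
  have hX0 : 0 < X := by positivity
  have hX16 : X ^ 16 = τ := by rw [hX, ← Real.rpow_mul_natCast hτ0]; norm_num
  have es : 1 + (x : ℂ) + I * s.im = s := by
    apply Complex.ext <;> simp [hx]
  have n1 : (1 + (x : ℂ)) ≠ 1 := by simpa using hx0.ne'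
  have n2 : s ≠ 1 := by rintro rfl; simp at hs1
  have n3 : 1 + (x : ℂ) + 2 * I * s.im ≠ 1 := by
    intro h; have := congrArg re h; simp at this; exact hx0.ne' this
  simp only [DirichletCharacter.LFunctionTrivChar, one_pow, DirichletCharacter.LFunction_modOne_eq, es,
    riemannZeta_eq_inv_sub_mul n1, riemannZeta_eq_inv_sub_mul n2,
    riemannZeta_eq_inv_sub_mul n3] at key
  rw [norm_mul, norm_mul, norm_pow, norm_pow, norm_mul, norm_mul, norm_mul, norm_inv, norm_inv,
    norm_inv] at key
  have b1 : ‖riemannZeta₁ (1 + x)‖ ≤ C := by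
    refine (h _ (by simp; linarith) (by simp; linarith)).trans (by simp)
  have b3 : ‖riemannZeta₁ (1 + x + 2 * I * s.im)‖ ≤ 4 * C * X ^ 17 := by
    refine (h _ (by simp; linarith) (by simp; linarith)).trans ?_
    rw [hX, ← rpow_seventeen_div_sixteen hτ0, show 4 * C * τ ^ (17 / 16 : ℝ) =
      C * (4 * τ ^ (17 / 16 : ℝ)) by ring]
    refine mul_le_mul_of_nonneg_left (le_trans ?_ (two_mul_rpow_le hτ0)) hC.le
    refine Real.rpow_le_rpow (by positivity) ?_ (by norm_num)
    simp [abs_mul, hτ]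
    linarith
  have m1 : ‖1 + (x : ℂ) - 1‖ = x := by simp [abs_of_pos hx0]
  have m2 : τ / 2 ≤ ‖s - 1‖ := by
    refine le_trans ?_ (abs_im_le_norm _)
    simp [hτ]; linarith
  have m3 : τ ≤ ‖1 + (x : ℂ) + 2 * I * s.im - 1‖ := by
    refine le_trans ?_ (abs_im_le_norm _)
    simp [hτ, abs_mul]; linarith
  have hτp : 0 < τ := by positivity
  have key2 : 1 ≤ (x⁻¹ * C) ^ 3 * ((τ / 2)⁻¹ * ‖riemannZeta₁ s‖) ^ 4 *
      (τ⁻¹ * (4 * C * X ^ 17)) := by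
    refine key.trans ?_
    rw [m1]
    gcongr
  rw [← hX16] at key2
  have e : (x⁻¹ * C) ^ 3 * ((X ^ 16 / 2)⁻¹ * ‖riemannZeta₁ s‖) ^ 4 *
      ((X ^ 16)⁻¹ * (4 * C * X ^ 17)) =
      (64 * C ^ 4 * ‖riemannZeta₁ s‖ ^ 4) / (x ^ 3 * X ^ 63) := by
    field_simp; ring
  rw [e, one_le_div (by positivity)] at key2
  exact key2

lemma exists_le_norm_riemannZeta₁ :
    ∃ c > 0, ∀ s : ℂ, 1 < s.re → s.re ≤ 2 → 1 ≤ |s.im| →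
      c * ((1 + |s.im|) ^ (1 / 16 : ℝ)) ^ 12 ≤ ‖riemannZeta₁ s‖ := by
  obtain ⟨K, hK, h⟩ := exists_re_sub_one_pow_mul_le
  obtain ⟨D, hD, hd⟩ := exists_norm_iteratedDeriv_riemannZeta₁_le 1
  set k := max K 1
  have hk1 : 1 ≤ k := le_max_right _ _
  have hkK : K ≤ k ^ 4 := (le_max_left _ _).trans (le_self_pow₀ hk1 (by norm_num))
  set η := min 1 (1 / (2 * k * D)) with hη
  have hη0 : 0 < η := by positivity
  have hη1 : η ≤ 1 := min_le_left _ _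
  have hηD : η * D ≤ 1 / (2 * k) := by
    calc η * D ≤ 1 / (2 * k * D) * D := by gcongr; exact min_le_right _ _
      _ = _ := by field_simp
  have far : ∀ s : ℂ, 1 < s.re → s.re ≤ 2 → 1 ≤ |s.im| →
      η ^ 4 / ((1 + |s.im|) ^ (1 / 16 : ℝ)) ^ 5 ≤ s.re - 1 →
      η ^ 3 / k * ((1 + |s.im|) ^ (1 / 16 : ℝ)) ^ 12 ≤ ‖riemannZeta₁ s‖ := by
    intro s hs1 hs2 hs3 hs4
    have hX0 : 0 < (1 + |s.im|) ^ (1 / 16 : ℝ) := by positivity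
    have h1 := h s hs1 hs2 hs3
    set X := (1 + |s.im|) ^ (1 / 16 : ℝ)
    have h2 : (η ^ 3 * X ^ 12) ^ 4 ≤ (k * ‖riemannZeta₁ s‖) ^ 4 :=
      calc (η ^ 3 * X ^ 12) ^ 4 = (η ^ 4 / X ^ 5) ^ 3 * X ^ 63 := by field_simp
        _ ≤ (s.re - 1) ^ 3 * X ^ 63 := by gcongr
        _ ≤ K * ‖riemannZeta₁ s‖ ^ 4 := h1
        _ ≤ k ^ 4 * ‖riemannZeta₁ s‖ ^ 4 := by gcongr
        _ = _ := by ring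
    have h3 := le_of_pow_le_pow_left₀ (by norm_num) (by positivity) h2
    rw [div_mul_eq_mul_div, div_le_iff₀ (by positivity)]
    linarith
  refine ⟨η ^ 3 / (2 * k), by positivity, fun s hs1 hs2 hs3 => ?_⟩
  set X := (1 + |s.im|) ^ (1 / 16 : ℝ) with hX
  have hX1 : 1 ≤ X := Real.one_le_rpow (by linarith [abs_nonneg s.im]) (by norm_num)
  set x₀ := η ^ 4 / X ^ 5 with hx₀
  have hx₀0 : 0 < x₀ := by positivity
  have hx₀1 : x₀ ≤ 1 := div_le_one_of_le₀
    ((pow_le_one₀ hη0.le hη1).trans (one_le_pow₀ hX1)) (by positivity)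
  rcases le_or_gt x₀ (s.re - 1) with hx | hx
  · refine le_trans ?_ (far s hs1 hs2 hs3 hx)
    gcongr
    linarith
  · set w : ℂ := ⟨1 + x₀, s.im⟩ with hw
    have h1 := far w (by simp [hw, hx₀0]) (by simp [hw]; linarith) hs3 (by simp [hw, hx₀, hX])
    have hseg : ∀ z ∈ segment ℝ s w, 1 ≤ z.re ∧ z.re ≤ 2 ∧ z.im = s.im := by
      rintro z ⟨a, b, ha, hb, hab, rfl⟩
      have e : b = 1 - a := by linarith
      subst e
      simp only [real_smul, add_re, re_ofReal_mul, add_im, im_ofReal_mul, hw]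
      refine ⟨?_, ?_, by ring⟩ <;> nlinarith
    have h2 := (convex_segment s w).norm_image_sub_le_of_norm_deriv_le (𝕜 := ℂ)
      (f := riemannZeta₁) (C := D * X ^ 17)
      (fun z _ => differentiable_riemannZeta₁.differentiableAt) (fun z hz => by
        obtain ⟨hz1, hz2, hz3⟩ := hseg z hz
        have := hd z hz1 hz2
        rwa [iteratedDeriv_one, hz3, rpow_seventeen_div_sixteen (by positivity)] at this)
      (left_mem_segment ℝ s w) (right_mem_segment ℝ s w)
    have h3 : ‖w - s‖ ≤ x₀ := by
      have : w - s = ((1 + x₀ - s.re : ℝ) : ℂ) := by apply Complex.ext <;> simp [hw]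
      rw [this, norm_real, Real.norm_eq_abs, abs_of_nonneg (by linarith)]
      linarith
    have h4 : ‖riemannZeta₁ w - riemannZeta₁ s‖ ≤ η ^ 3 / (2 * k) * X ^ 12 :=
      calc _ ≤ D * X ^ 17 * ‖w - s‖ := h2
        _ ≤ D * X ^ 17 * x₀ := by gcongr
        _ = (η * D) * η ^ 3 * X ^ 12 := by rw [hx₀]; field_simp
        _ ≤ 1 / (2 * k) * η ^ 3 * X ^ 12 := by gcongr
        _ = _ := by ring
    have h5 : η ^ 3 / k * X ^ 12 ≤ ‖riemannZeta₁ w‖ := h1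
    have h6 := norm_sub_norm_le (riemannZeta₁ w) (riemannZeta₁ s)
    have h7 : η ^ 3 / k * X ^ 12 = 2 * (η ^ 3 / (2 * k) * X ^ 12) := by field_simp
    linarith

/-- The analytic continuation of `-ζ'/ζ(z)/(z - 1) - 1/(z - 1)² + γ/(z - 1)`. -/
noncomputable def logDerivSlope (z : ℂ) : ℂ := -dslope (logDeriv riemannZeta₁) 1 z

lemma riemannZeta₁_ne_zero {z : ℂ} (hz : 1 ≤ z.re) : riemannZeta₁ z ≠ 0 := by
  rcases eq_or_ne z 1 with rfl | h
  · simp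
  · have := riemannZeta_ne_zero_of_one_le_re hz
    rw [riemannZeta_eq_inv_sub_mul h] at this
    exact right_ne_zero_of_mul this

lemma isOpen_riemannZeta₁_ne_zero : IsOpen {z | riemannZeta₁ z ≠ 0} :=
  isOpen_ne_fun differentiable_riemannZeta₁.continuous continuous_const

lemma differentiableOn_logDeriv_riemannZeta₁ :
    DifferentiableOn ℂ (logDeriv riemannZeta₁) {z | riemannZeta₁ z ≠ 0} :=
  DifferentiableOn.div (differentiable_riemannZeta₁.deriv.differentiableOn)
    differentiable_riemannZeta₁.differentiableOn fun _ h => h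

lemma differentiableOn_logDerivSlope :
    DifferentiableOn ℂ logDerivSlope {z | riemannZeta₁ z ≠ 0} :=
  ((differentiableOn_dslope (isOpen_riemannZeta₁_ne_zero.mem_nhds (by simp))).2
    differentiableOn_logDeriv_riemannZeta₁).neg

lemma logDeriv_riemannZeta₁_one : logDeriv riemannZeta₁ 1 = Real.eulerMascheroniConstant := by
  simp [logDeriv_apply]

lemma sub_one_mul_logDerivSlope (z : ℂ) :
    (z - 1) * logDerivSlope z = -(logDeriv riemannZeta₁ z - Real.eulerMascheroniConstant) := by
  rw [logDerivSlope, mul_neg, ← smul_eq_mul, sub_smul_dslope, logDeriv_riemannZeta₁_one]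

lemma norm_le_div_of_mul_eq {u w e : ℂ} {m B : ℝ} (hm : 0 < m) (hw : m ≤ ‖w‖) (h : w * u = e)
    (he : ‖e‖ ≤ B) : ‖u‖ ≤ B / m := by
  rw [le_div_iff₀ hm, mul_comm]
  calc m * ‖u‖ ≤ ‖w‖ * ‖u‖ := by gcongr
    _ = ‖e‖ := by rw [← norm_mul, h]
    _ ≤ B := he

lemma mul_deriv_eq_of_mul_eq {U : Set ℂ} (hU : IsOpen U) {A u v : ℂ → ℂ}
    (hA : DifferentiableOn ℂ A U) (hu : DifferentiableOn ℂ u U) (h : ∀ z ∈ U, A z * u z = v z) :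
    ∀ z ∈ U, A z * deriv u z = deriv v z - deriv A z * u z := by
  intro z hz
  have hev : v =ᶠ[𝓝 z] A * u := by
    filter_upwards [hU.mem_nhds hz] with w hw using (h w hw).symm
  rw [hev.deriv_eq, deriv_mul (hA.differentiableAt (hU.mem_nhds hz))
    (hu.differentiableAt (hU.mem_nhds hz))]
  ring

/-- Differentiating an identity `A * u = v` twice. -/
lemma mul_deriv_deriv_eq_of_mul_eq {U : Set ℂ} (hU : IsOpen U) {A u v : ℂ → ℂ}
    (hA : DifferentiableOn ℂ A U) (hu : DifferentiableOn ℂ u U) (hv : DifferentiableOn ℂ v U)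
    (h : ∀ z ∈ U, A z * u z = v z) :
    ∀ z ∈ U, A z * deriv (deriv u) z =
      deriv (deriv v) z - 2 * deriv A z * deriv u z - deriv (deriv A) z * u z := by
  intro z hz
  have hz' := hU.mem_nhds hz
  have h1 := mul_deriv_eq_of_mul_eq hU hA (hu.deriv hU) (mul_deriv_eq_of_mul_eq hU hA hu h) z hz
  rw [deriv_fun_sub ((hv.deriv hU).differentiableAt hz')
    (((hA.deriv hU).differentiableAt hz').fun_mul (hu.differentiableAt hz')),
    deriv_fun_mul ((hA.deriv hU).differentiableAt hz') (hu.differentiableAt hz')] at h1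
  rw [h1]
  ring

lemma exists_norm_deriv_deriv_logDerivSlope_le :
    ∃ M > 0, ∀ z : ℂ, 1 < z.re → z.re ≤ 2 → ‖deriv (deriv logDerivSlope) z‖ ≤ M := by
  have hU := isOpen_riemannZeta₁_ne_zero
  obtain ⟨M₀, hM₀⟩ : ∃ M₀, ∀ z ∈ Set.Icc (1 : ℝ) 2 ×ℂ Set.Icc (-1 : ℝ) 1,
      ‖deriv (deriv logDerivSlope) z‖ ≤ M₀ :=
    (isCompact_Icc.reProdIm isCompact_Icc).exists_bound_of_continuousOn
      (((differentiableOn_logDerivSlope.deriv hU).deriv hU).continuousOn.mono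
        fun z hz => riemannZeta₁_ne_zero hz.1.1)
  obtain ⟨c, hc, hlow⟩ := exists_le_norm_riemannZeta₁
  obtain ⟨D₁, hD₁, h₁⟩ := exists_norm_iteratedDeriv_riemannZeta₁_le 1
  obtain ⟨D₂, hD₂, h₂⟩ := exists_norm_iteratedDeriv_riemannZeta₁_le 2
  obtain ⟨D₃, hD₃, h₃⟩ := exists_norm_iteratedDeriv_riemannZeta₁_le 3
  set a := D₁ / c
  set b := (D₂ + D₁ * a) / c
  set d := (D₃ + 2 * D₁ * b + D₂ * a) / c
  set γ := |Real.eulerMascheroniConstant|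
  have ha : 0 < a := by positivity
  have hb : 0 < b := by positivity
  have hd : 0 < d := by positivity
  set g₀ := 2 * (a + γ)
  set g₁ := 2 * (b + g₀)
  have hg₀ : 0 ≤ g₀ := by positivity
  refine ⟨max M₀ (2 * (d + 2 * g₁)), lt_max_of_lt_right (by positivity), fun z hz1 hz2 => ?_⟩
  rcases le_or_gt |z.im| 1 with him | him
  · exact (hM₀ z ⟨⟨hz1.le, hz2⟩, abs_le.1 him⟩).trans (le_max_left _ _)
  refine le_trans ?_ (le_max_right _ _)
  have hzU : z ∈ {z | riemannZeta₁ z ≠ 0} := riemannZeta₁_ne_zero hz1.le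
  have hτ0 : 0 ≤ 1 + |z.im| := by positivity
  have hlow := hlow z hz1 hz2 him.le
  have h₁ := h₁ z hz1.le hz2
  have h₂ := h₂ z hz1.le hz2
  have h₃ := h₃ z hz1.le hz2
  rw [rpow_seventeen_div_sixteen hτ0] at h₁ h₂ h₃
  rw [iteratedDeriv_one] at h₁
  rw [iteratedDeriv_succ, iteratedDeriv_one] at h₂
  rw [iteratedDeriv_succ, iteratedDeriv_succ, iteratedDeriv_one] at h₃
  set X := (1 + |z.im|) ^ (1 / 16 : ℝ) with hX
  have hX1 : 1 ≤ X := Real.one_le_rpow (by linarith [abs_nonneg z.im]) (by norm_num)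
  have hX0 : 0 < X := by linarith
  have hX16 : X ^ 16 = 1 + |z.im| := by rw [hX, ← Real.rpow_mul_natCast hτ0]; norm_num
  have hm : 0 < c * X ^ 12 := by positivity
  have hW := differentiable_riemannZeta₁.differentiableOn (s := {z | riemannZeta₁ z ≠ 0})
  have hW' := hW.deriv hU
  have hL := differentiableOn_logDeriv_riemannZeta₁
  have hWL : ∀ z ∈ {z | riemannZeta₁ z ≠ 0},
      riemannZeta₁ z * logDeriv riemannZeta₁ z = deriv riemannZeta₁ z := fun z hz => by
    rw [logDeriv_apply, mul_div_cancel₀ _ hz]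
  have L0 : ‖logDeriv riemannZeta₁ z‖ ≤ a * X ^ 5 :=
    (norm_le_div_of_mul_eq hm hlow (hWL z hzU) h₁).trans_eq (by simp only [a]; field_simp)
  have L1 : ‖deriv (logDeriv riemannZeta₁) z‖ ≤ b * X ^ 10 := by
    refine (norm_le_div_of_mul_eq (B := D₂ * X ^ 17 * X ^ 5 + D₁ * X ^ 17 * (a * X ^ 5)) hm hlow
      (mul_deriv_eq_of_mul_eq hU hW hL hWL z hzU) ?_).trans_eq (by simp only [b]; field_simp)
    refine (norm_sub_le _ _).trans (add_le_add ?_ ?_)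
    · exact h₂.trans (le_mul_of_one_le_right (by positivity) (one_le_pow₀ hX1))
    · rw [norm_mul]; gcongr
  have L2 : ‖deriv (deriv (logDeriv riemannZeta₁)) z‖ ≤ d * X ^ 15 := by
    refine (norm_le_div_of_mul_eq (B := D₃ * X ^ 17 * X ^ 10 + 2 * (D₁ * X ^ 17) * (b * X ^ 10) +
      D₂ * X ^ 17 * (a * X ^ 5) * X ^ 5) hm hlow
      (mul_deriv_deriv_eq_of_mul_eq hU hW hL hW' hWL z hzU) ?_).trans_eq
        (by simp only [d]; field_simp)
    refine (norm_sub_le _ _).trans (add_le_add ((norm_sub_le _ _).trans (add_le_add ?_ ?_)) ?_)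
    · exact h₃.trans (le_mul_of_one_le_right (by positivity) (one_le_pow₀ hX1))
    · rw [norm_mul, norm_mul, norm_ofNat]; gcongr
    · rw [norm_mul]
      refine le_trans ?_ (le_mul_of_one_le_right (by positivity) (one_le_pow₀ hX1))
      gcongr
  have hm' : 0 < X ^ 16 / 2 := by positivity
  have hz1' : X ^ 16 / 2 ≤ ‖z - 1‖ := by
    refine le_trans ?_ (abs_im_le_norm _)
    rw [hX16, sub_im, one_im, sub_zero]; linarith
  have hG := differentiableOn_logDerivSlope
  have hA : DifferentiableOn ℂ (fun z : ℂ => z - 1) {z | riemannZeta₁ z ≠ 0} := by fun_prop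
  have hA1 : deriv (fun z : ℂ => z - 1) = fun _ => 1 := by ext; simp
  have hL' : DifferentiableOn ℂ
      (fun z => -(logDeriv riemannZeta₁ z - Real.eulerMascheroniConstant))
      {z | riemannZeta₁ z ≠ 0} := by fun_prop
  have hL1 : deriv (fun z => -(logDeriv riemannZeta₁ z - Real.eulerMascheroniConstant)) =
      fun z => -deriv (logDeriv riemannZeta₁) z := by ext; simp
  have bound : ∀ {u v : ℂ} {B : ℝ}, (z - 1) * u = v → 0 ≤ B → ‖v‖ ≤ B * X ^ 16 → ‖u‖ ≤ 2 * B := by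
    intro u v B huv hB hv
    exact (norm_le_div_of_mul_eq hm' hz1' huv hv).trans_eq (by field_simp)
  have G0 : ‖logDerivSlope z‖ ≤ g₀ := by
    refine bound (sub_one_mul_logDerivSlope z) (by positivity) ?_
    rw [norm_neg]
    refine (norm_sub_le _ _).trans ?_
    rw [norm_real, Real.norm_eq_abs, add_mul]
    refine add_le_add (L0.trans ?_) (le_mul_of_one_le_right (abs_nonneg _) (one_le_pow₀ hX1))
    gcongr; norm_num
  have G1 : ‖deriv logDerivSlope z‖ ≤ g₁ := by
    refine bound (mul_deriv_eq_of_mul_eq hU hA hG (fun z _ => sub_one_mul_logDerivSlope z) z hzU)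
      (by positivity) ?_
    rw [hL1, hA1, one_mul]
    refine (norm_sub_le _ _).trans ?_
    rw [norm_neg, add_mul]
    refine add_le_add (L1.trans ?_)
      (G0.trans (le_mul_of_one_le_right (by positivity) (one_le_pow₀ hX1)))
    gcongr; norm_num
  refine bound (mul_deriv_deriv_eq_of_mul_eq hU hA hG hL'
    (fun z _ => sub_one_mul_logDerivSlope z) z hzU) (by positivity) ?_
  rw [hL1, hA1]
  simp only [deriv_const, zero_mul, sub_zero, mul_one, deriv.fun_neg]
  refine (norm_sub_le _ _).trans ?_
  rw [norm_neg, add_mul, norm_mul, norm_ofNat]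
  refine add_le_add (L2.trans ?_) ?_
  · gcongr; norm_num
  · refine le_trans ?_ (le_mul_of_one_le_right (by positivity) (one_le_pow₀ hX1))
    gcongr

end

section

open Complex Filter Topology Asymptotics MeasureTheory Set
open scoped FourierTransform SchwartzMap ContDiff

/-- Functions supported in `(0, 1]` which grow slower than any power of `t⁻¹` at `0`. -/
structure IsMellinTame (f : ℝ → ℂ) : Prop where
  locallyIntegrableOn : LocallyIntegrableOn f (Ioi 0)
  eq_zero : ∀ t, 1 < t → f t = 0
  isBigO : ∀ b : ℝ, 0 < b → f =O[𝓝[>] 0] (· ^ (-b))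

namespace IsMellinTame

variable {f g : ℝ → ℂ}

lemma add (hf : IsMellinTame f) (hg : IsMellinTame g) : IsMellinTame (fun t => f t + g t) where
  locallyIntegrableOn := hf.locallyIntegrableOn.add hg.locallyIntegrableOn
  eq_zero t ht := by simp [hf.eq_zero t ht, hg.eq_zero t ht]
  isBigO b hb := (hf.isBigO b hb).add (hg.isBigO b hb)

lemma const_smul (hf : IsMellinTame f) (c : ℂ) : IsMellinTame (fun t => c • f t) where
  locallyIntegrableOn := hf.locallyIntegrableOn.smul c
  eq_zero t ht := by simp [hf.eq_zero t ht]
  isBigO b hb := (hf.isBigO b hb).const_smul_left c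

lemma log_smul (hf : IsMellinTame f) : IsMellinTame (fun t => Real.log t • f t) where
  locallyIntegrableOn := hf.locallyIntegrableOn.continuousOn_smul isOpen_Ioi.isLocallyClosed
    (Real.continuousOn_log.mono fun t ht => ne_of_gt ht)
  eq_zero t ht := by simp [hf.eq_zero t ht]
  isBigO b hb := isBigO_rpow_zero_log_smul (half_lt_self hb) (hf.isBigO (b / 2) (half_pos hb))

lemma isBigO_atTop (hf : IsMellinTame f) (a : ℝ) : f =O[atTop] (· ^ (-a)) := by
  refine EventuallyEq.trans_isBigO (f₂ := fun _ => 0) ?_ (isBigO_zero _ _)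
  filter_upwards [eventually_gt_atTop 1] with t ht using hf.eq_zero t ht

lemma mellinConvergent (hf : IsMellinTame f) {s : ℂ} (hs : 0 < s.re) : MellinConvergent f s :=
  mellinConvergent_of_isBigO_rpow hf.locallyIntegrableOn (hf.isBigO_atTop (s.re + 1))
    (by linarith) (hf.isBigO (s.re / 2) (half_pos hs)) (half_lt_self hs)

lemma hasDerivAt_mellin (hf : IsMellinTame f) {s : ℂ} (hs : 0 < s.re) :
    HasDerivAt (mellin f) (mellin (fun t => Real.log t • f t) s) s :=
  (mellin_hasDerivAt_of_isBigO_rpow hf.locallyIntegrableOn (hf.isBigO_atTop (s.re + 1))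
    (by linarith) (hf.isBigO (s.re / 2) (half_pos hs)) (half_lt_self hs)).2

end IsMellinTame

/-- The summatory function of `Λ(n)/n`. -/
noncomputable def vonMangoldtSum (x : ℝ) : ℝ :=
  ∑ k ∈ Finset.Icc 1 ⌊x⌋₊, ArithmeticFunction.vonMangoldt k / k

/-- The error term in Mertens' first theorem for the von Mangoldt function. -/
noncomputable def mertensError (x : ℝ) : ℝ :=
  vonMangoldtSum x - Real.log x + Real.eulerMascheroniConstant

lemma monotone_vonMangoldtSum : Monotone vonMangoldtSum := fun x y hxy =>
  Finset.sum_le_sum_of_subset_of_nonneg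
    (Finset.Icc_subset_Icc_right (Nat.floor_mono hxy)) fun _ _ _ => by
      have := @ArithmeticFunction.vonMangoldt_nonneg
      positivity

lemma vonMangoldtSum_nonneg (x : ℝ) : 0 ≤ vonMangoldtSum x :=
  Finset.sum_nonneg fun _ _ => div_nonneg ArithmeticFunction.vonMangoldt_nonneg (by positivity)

lemma vonMangoldtSum_of_lt_one {x : ℝ} (hx : x < 1) : vonMangoldtSum x = 0 := by
  simp [vonMangoldtSum, Nat.floor_eq_zero.2 hx]

lemma vonMangoldtSum_le {x : ℝ} (hx : 1 ≤ x) :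
    vonMangoldtSum x ≤ Real.log x * (1 + Real.log x) := by
  have hfl : (1 : ℝ) ≤ ⌊x⌋₊ := by exact_mod_cast Nat.le_floor (by simpa using hx)
  have hlog : Real.log ⌊x⌋₊ ≤ Real.log x :=
    Real.log_le_log (by linarith) (Nat.floor_le (by linarith))
  calc vonMangoldtSum x ≤ ∑ k ∈ Finset.Icc 1 ⌊x⌋₊, Real.log x * (k : ℝ)⁻¹ := by
        refine Finset.sum_le_sum fun k hk => ?_
        rw [Finset.mem_Icc] at hk
        rw [div_eq_mul_inv]
        gcongr
        refine ArithmeticFunction.vonMangoldt_le_log.trans (le_trans ?_ hlog)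
        exact Real.log_le_log (by exact_mod_cast hk.1) (by exact_mod_cast hk.2)
    _ = Real.log x * (harmonic ⌊x⌋₊ : ℚ) := by
        rw [← Finset.mul_sum, harmonic_eq_sum_Icc]; push_cast; rfl
    _ ≤ _ := by
        have := Real.log_nonneg hx
        gcongr
        exact (harmonic_le_one_add_log _).trans (by gcongr)

lemma isBigO_vonMangoldtSum {b : ℝ} (hb : 0 < b) : vonMangoldtSum =O[atTop] (· ^ b) := by
  have h1 : Real.log =O[atTop] (fun x : ℝ => x ^ (b / 2)) :=
    (isLittleO_log_rpow_atTop (half_pos hb)).isBigO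
  have h2 : (fun x => 1 + Real.log x) =O[atTop] (fun x : ℝ => x ^ (b / 2)) := by
    refine IsBigO.add ?_ h1
    refine IsBigO.of_bound 1 ?_
    filter_upwards [eventually_ge_atTop 1] with x hx
    have := Real.one_le_rpow hx (half_pos hb).le
    simpa using this.trans (le_abs_self _)
  have h3 : (fun x => Real.log x * (1 + Real.log x)) =O[atTop] (fun x : ℝ => x ^ b) := by
    refine (h1.mul h2).congr' EventuallyEq.rfl ?_
    filter_upwards [eventually_gt_atTop 0] with x hx
    rw [← Real.rpow_add hx, add_halves]
  refine IsBigO.trans (IsBigO.of_bound 1 ?_) h3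
  filter_upwards [eventually_ge_atTop 1] with x hx
  rw [one_mul, Real.norm_of_nonneg (vonMangoldtSum_nonneg x)]
  exact (vonMangoldtSum_le hx).trans (Real.le_norm_self _)

lemma isMellinTame_vonMangoldtSum : IsMellinTame (fun t => (vonMangoldtSum t⁻¹ : ℂ)) where
  locallyIntegrableOn := by
    rw [locallyIntegrableOn_iff isOpen_Ioi.isLocallyClosed]
    intro k hk hkc
    refine Integrable.ofReal (AntitoneOn.integrableOn_isCompact hkc fun x hx y hy hxy => ?_)
    exact monotone_vonMangoldtSum (inv_anti₀ (hk hx) hxy)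
  eq_zero t ht := by simp [vonMangoldtSum_of_lt_one (inv_lt_one_of_one_lt₀ ht)]
  isBigO b hb := by
    rw [← isBigO_norm_left]
    simp only [norm_real]
    rw [isBigO_norm_left]
    refine ((isBigO_vonMangoldtSum hb).comp_tendsto tendsto_inv_nhdsGT_zero).congr'
      EventuallyEq.rfl ?_
    filter_upwards [self_mem_nhdsWithin] with t (ht : 0 < t)
    simp [Real.rpow_neg ht.le, Real.inv_rpow ht.le]

lemma isMellinTame_indicator_one : IsMellinTame (indicator (Ioc 0 1) (fun _ => 1)) where
  locallyIntegrableOn := ((integrable_indicator_iff measurableSet_Ioc).2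
    (integrableOn_const (by simp))).locallyIntegrable.locallyIntegrableOn _
  eq_zero t ht := by simp [ht]
  isBigO b hb := by
    refine IsBigO.of_bound 1 ?_
    filter_upwards [Ioo_mem_nhdsGT zero_lt_one] with t ht
    rw [indicator_of_mem (show t ∈ Ioc 0 1 from ⟨ht.1, ht.2.le⟩), norm_one, one_mul]
    refine le_trans ?_ (le_abs_self _)
    exact Real.one_le_rpow_of_pos_of_le_one_of_nonpos ht.1 ht.2.le (by linarith)

lemma mellin_vonMangoldtSum {s : ℂ} (hs : 0 < s.re) :
    mellin (fun t => (vonMangoldtSum t⁻¹ : ℂ)) s =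
      -deriv riemannZeta (1 + s) / riemannZeta (1 + s) / s := by
  have hs0 : s ≠ 0 := by rintro rfl; simp at hs
  have key := LSeries_eq_mul_integral_of_nonneg
    (fun k : ℕ => ArithmeticFunction.vonMangoldt k / k) (half_pos hs).le (half_lt_self hs) ?_
    fun _ => div_nonneg ArithmeticFunction.vonMangoldt_nonneg (by positivity)
  · have hL : LSeries (fun k : ℕ => ((ArithmeticFunction.vonMangoldt k / k : ℝ) : ℂ)) s =
        LSeries (fun k => (ArithmeticFunction.vonMangoldt k : ℂ)) (1 + s) := by
      refine tsum_congr fun n => ?_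
      rcases eq_or_ne n 0 with rfl | hn
      · simp
      have : (n : ℂ) ≠ 0 := by exact_mod_cast hn
      rw [LSeries.term_of_ne_zero hn, LSeries.term_of_ne_zero hn, cpow_add _ _ this, cpow_one]
      push_cast
      rw [div_div]
    rw [hL, ArithmeticFunction.LSeries_vonMangoldt_eq_deriv_riemannZeta_div (by simpa using hs)]
      at key
    rw [key, mul_div_cancel_left₀ _ hs0, mellin_comp_inv (fun t => (vonMangoldtSum t : ℂ)), mellin,
      ← integral_indicator measurableSet_Ioi, ← integral_indicator measurableSet_Ioi]
    congr 1 with t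
    by_cases h1 : 1 < t
    · rw [indicator_of_mem (show t ∈ Ioi 1 from h1),
        indicator_of_mem (show t ∈ Ioi 0 from zero_lt_one.trans h1), vonMangoldtSum, smul_eq_mul,
        mul_comm, ofReal_sum]
      congr 2
      ring
    · rw [indicator_of_notMem (show t ∉ Ioi 1 from h1), indicator_apply_eq_zero]
      intro _
      rcases (not_lt.1 h1).eq_or_lt with rfl | h
      · simp [vonMangoldtSum]
      · simp [vonMangoldtSum_of_lt_one h]
  · refine ((isBigO_vonMangoldtSum (half_pos hs)).comp_tendsto
      tendsto_natCast_atTop_atTop).congr_left fun n => ?_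
    simp [vonMangoldtSum]

lemma mellin_log_smul_indicator_one {s : ℂ} (hs : 0 < s.re) :
    mellin (fun t => Real.log t • indicator (Ioc 0 1) (fun _ => (1 : ℂ)) t) s = -1 / s ^ 2 := by
  have hs0 : s ≠ 0 := by rintro rfl; simp at hs
  have h1 := isMellinTame_indicator_one.hasDerivAt_mellin hs
  have h2 : mellin (indicator (Ioc 0 1) (fun _ => (1 : ℂ))) =ᶠ[𝓝 s] fun s => s⁻¹ := by
    filter_upwards [(isOpen_lt continuous_const continuous_re).mem_nhds hs] with w hw
    rw [(hasMellin_one_Ioc hw).2, one_div]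
  rw [← h1.deriv, h2.deriv_eq, (hasDerivAt_inv hs0).deriv, neg_div, one_div]

/-- `t ↦ mertensError t⁻¹`, cut off to `(0, 1]`. -/
noncomputable def mertensErrorInv (t : ℝ) : ℂ :=
  vonMangoldtSum t⁻¹ + Real.log t • indicator (Ioc 0 1) (fun _ => (1 : ℂ)) t +
    (Real.eulerMascheroniConstant : ℂ) • indicator (Ioc 0 1) (fun _ => (1 : ℂ)) t

lemma isMellinTame_mertensErrorInv : IsMellinTame mertensErrorInv :=
  (isMellinTame_vonMangoldtSum.add isMellinTame_indicator_one.log_smul).add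
    (isMellinTame_indicator_one.const_smul _)

lemma mertensErrorInv_eq {t : ℝ} (h0 : 0 < t) (h1 : t ≤ 1) :
    mertensErrorInv t = mertensError t⁻¹ := by
  simp [mertensErrorInv, mertensError, h0, h1]

lemma mellin_mertensErrorInv {s : ℂ} (hs : 0 < s.re) :
    mellin mertensErrorInv s = logDerivSlope (1 + s) := by
  have hs0 : s ≠ 0 := by rintro rfl; simp at hs
  have A := isMellinTame_vonMangoldtSum
  have B := isMellinTame_indicator_one
  have h1 := (hasMellin_add ((A.add B.log_smul).mellinConvergent hs)
    ((B.const_smul (Real.eulerMascheroniConstant : ℂ)).mellinConvergent hs)).2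
  have h2 := (hasMellin_add (A.mellinConvergent hs) (B.log_smul.mellinConvergent hs)).2
  have hG := sub_one_mul_logDerivSlope (1 + s)
  have hs1 : 1 + s ≠ 1 := by simpa using hs0
  have hζ : riemannZeta (1 + s) ≠ 0 :=
    riemannZeta_ne_zero_of_one_le_re (by simpa using hs.le)
  have hev : riemannZeta₁ =ᶠ[𝓝 (1 + s)] fun z => (z - 1) * riemannZeta z := by
    filter_upwards [isOpen_ne.mem_nhds hs1] with z hz
    rw [riemannZeta_eq_inv_sub_mul hz, mul_inv_cancel_left₀ (sub_ne_zero.2 hz)]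
  have hL : logDeriv riemannZeta₁ (1 + s) =
      1 / s + deriv riemannZeta (1 + s) / riemannZeta (1 + s) := by
    rw [logDeriv_apply, hev.deriv_eq, hev.eq_of_nhds, deriv_fun_mul (by fun_prop)
      (differentiableAt_riemannZeta hs1)]
    simp only [deriv_sub_const, deriv_id'', add_sub_cancel_left]
    field_simp
  rw [hL, add_sub_cancel_left] at hG
  refine h1.trans ?_
  rw [h2, mellin_vonMangoldtSum hs, mellin_log_smul_indicator_one hs, mellin_const_smul,
    (hasMellin_one_Ioc hs).2]
  refine mul_left_cancel₀ hs0 (Eq.trans ?_ hG.symm)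
  rw [smul_eq_mul]
  field_simp
  ring

lemma mellin_log_log_mertensErrorInv {s : ℂ} (hs : 0 < s.re) :
    mellin (fun t => Real.log t • Real.log t • mertensErrorInv t) s =
      deriv (deriv logDerivSlope) (1 + s) := by
  have key : ∀ {f : ℝ → ℂ} {g : ℂ → ℂ}, IsMellinTame f →
      (∀ s : ℂ, 0 < s.re → mellin f s = g (1 + s)) →
      ∀ s : ℂ, 0 < s.re → mellin (fun t => Real.log t • f t) s = deriv g (1 + s) := by
    intro f g hf hfg s hs
    rw [← (hf.hasDerivAt_mellin hs).deriv, ← deriv_comp_const_add]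
    apply EventuallyEq.deriv_eq
    filter_upwards [(isOpen_lt continuous_const continuous_re).mem_nhds hs] with w hw
    exact hfg w hw
  have T := isMellinTame_mertensErrorInv
  exact key T.log_smul (key T fun s hs => mellin_mertensErrorInv hs) s hs

lemma MellinConvergent.integrable_exp_smul {f : ℝ → ℂ} {σ : ℝ} (hf : MellinConvergent f σ) :
    Integrable (fun u : ℝ => Real.exp (-σ * u) • f (Real.exp (-u))) := by
  have himg : image (fun u : ℝ => Real.exp (-u)) univ = Ioi 0 := by
    rw [image_univ, ← Real.range_exp]
    exact neg_surjective.range_comp Real.exp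
  have hd : ∀ u ∈ univ, HasDerivWithinAt (fun u : ℝ => Real.exp (-u)) (-Real.exp (-u)) univ u :=
    fun u _ => by
      have := (hasDerivAt_neg u).exp
      rw [mul_neg_one] at this
      exact this.hasDerivWithinAt
  have hinj : InjOn (fun u : ℝ => Real.exp (-u)) univ :=
    (Real.exp_injective.comp neg_injective).injOn
  rw [MellinConvergent, ← himg, integrableOn_image_iff_integrableOn_abs_deriv_smul
    MeasurableSet.univ hd hinj, integrableOn_univ] at hf
  refine hf.congr (Eventually.of_forall fun u => ?_)
  have : ((Real.exp (-u) : ℝ) : ℂ) ^ ((σ : ℂ) - 1) = ((Real.exp (-σ * u) * Real.exp u : ℝ) : ℂ) := by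
    rw [← ofReal_one, ← ofReal_sub, ← ofReal_cpow (Real.exp_pos _).le, ← Real.exp_mul,
      ← Real.exp_add]
    ring_nf
  simp only [this, abs_neg, Real.abs_exp, smul_eq_mul, real_smul]
  rw [← mul_assoc, ← ofReal_mul, mul_left_comm, ← Real.exp_add, neg_add_cancel, Real.exp_zero,
    mul_one]

lemma fourier_exp_smul_comp_div (ψ : ℝ → ℂ) {v : ℝ} (hv : 0 < v) (u : ℝ) :
    𝓕 (fun ξ : ℝ => cexp (2 * Real.pi * v * ξ * I) * (v⁻¹ • ψ (ξ / v))) u = 𝓕 ψ (v * (u - v)) := by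
  rw [Real.fourier_real_eq_integral_exp_smul, Real.fourier_real_eq_integral_exp_smul]
  have := Measure.integral_comp_div (fun ξ : ℝ =>
    cexp (↑(-2 * Real.pi * ξ * (v * (u - v))) * I) • ψ ξ) v
  rw [abs_of_pos hv, ← inv_smul_eq_iff₀ hv.ne', ← integral_smul] at this
  rw [← this]
  congr 1 with ξ
  simp only [smul_eq_mul, real_smul]
  rw [mul_left_comm, ← mul_assoc (cexp _), ← Complex.exp_add]
  have : (v : ℂ) ≠ 0 := by exact_mod_cast hv.ne'
  rw [mul_left_comm]
  congr 4
  push_cast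
  field_simp
  ring

lemma integral_fourier_smul_eq_of_integrable {f g : ℝ → ℂ} (hf : Integrable f)
    (hg : Integrable g) : ∫ ξ, 𝓕 f ξ • g ξ = ∫ u, f u • 𝓕 g u := by
  simpa using! VectorFourier.integral_fourierIntegral_smul_eq_flip (L := innerₗ ℝ)
    Real.continuous_fourierChar continuous_inner hf hg

lemma exists_norm_integral_mertensErrorInv_le (φ : 𝓢(ℝ, ℂ)) :
    ∃ C > 0, ∀ v : ℝ, 1 ≤ v →
      Integrable (fun u => (Real.exp (-v⁻¹ * u) • (Real.log (Real.exp (-u)) •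
        Real.log (Real.exp (-u)) • mertensErrorInv (Real.exp (-u)))) • φ (v * (u - v))) ∧
      ‖∫ u, (Real.exp (-v⁻¹ * u) • (Real.log (Real.exp (-u)) • Real.log (Real.exp (-u)) •
        mertensErrorInv (Real.exp (-u)))) • φ (v * (u - v))‖ ≤ C := by
  obtain ⟨M, hM, hG⟩ := exists_norm_deriv_deriv_logDerivSlope_le
  set ψ : 𝓢(ℝ, ℂ) := 𝓕⁻ φ
  have hψ : 𝓕 (ψ : ℝ → ℂ) = φ := by
    rw [← SchwartzMap.fourier_coe]; simp [ψ]
  refine ⟨M * (∫ ξ, ‖ψ ξ‖) + 1, by positivity, fun v hv => ?_⟩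
  have hv0 : 0 < v := by linarith
  have hσ : 0 < v⁻¹ := by positivity
  set F : ℝ → ℂ := fun t => Real.log t • Real.log t • mertensErrorInv t
  set h : ℝ → ℂ := fun u => Real.exp (-v⁻¹ * u) • F (Real.exp (-u))
  set g : ℝ → ℂ := fun ξ => cexp (2 * Real.pi * v * ξ * I) * (v⁻¹ • ψ (ξ / v))
  have hgn : ∀ ξ, ‖g ξ‖ = v⁻¹ * ‖ψ (ξ / v)‖ := fun ξ => by
    have : cexp (2 * Real.pi * v * ξ * I) = cexp ((2 * Real.pi * v * ξ : ℝ) * I) := by push_cast; rfl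
    rw [norm_mul, this, norm_exp_ofReal_mul_I, one_mul, norm_smul, Real.norm_of_nonneg hσ.le]
  have hg : Integrable g := by
    refine Integrable.mono' ((ψ.integrable.norm.comp_div hv0.ne').const_mul v⁻¹) ?_
      (Eventually.of_forall fun ξ => (hgn ξ).le)
    have := ψ.continuous
    exact Continuous.aestronglyMeasurable (by fun_prop)
  have hgint : ∫ ξ, ‖g ξ‖ = ∫ ξ, ‖ψ ξ‖ := by
    simp_rw [hgn]
    rw [integral_const_mul, Measure.integral_comp_div (fun ξ => ‖ψ ξ‖), smul_eq_mul,
      abs_of_pos hv0, inv_mul_cancel_left₀ hv0.ne']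
  have hF : IsMellinTame F := isMellinTame_mertensErrorInv.log_smul.log_smul
  have hh : Integrable h := (hF.mellinConvergent (by simpa using hv0)).integrable_exp_smul
  have hfh : ∀ ξ, ‖𝓕 h ξ‖ ≤ M := fun ξ => by
    have hs : (⟨v⁻¹, 2 * Real.pi * ξ⟩ : ℂ).re = v⁻¹ := rfl
    have h1 := mellin_eq_fourier F (s := ⟨v⁻¹, 2 * Real.pi * ξ⟩)
    rw [mellin_log_log_mertensErrorInv (by rwa [hs]), mul_div_cancel_left₀ _ (by positivity)] at h1
    rw [show 𝓕 h ξ = _ from h1.symm]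
    have : v⁻¹ ≤ 1 := inv_le_one_of_one_le₀ hv
    exact hG _ (by simpa using hv0) (by rw [add_re, one_re, hs]; linarith)
  have hφ : ∀ u, φ (v * (u - v)) = 𝓕 g u := fun u => by
    rw [fourier_exp_smul_comp_div ψ hv0, hψ]
  have hφc := φ.continuous
  refine ⟨hh.mul_bdd (g := fun u => φ (v * (u - v))) (c := SchwartzMap.seminorm ℝ 0 0 φ)
    (Continuous.aestronglyMeasurable (by fun_prop))
    (Eventually.of_forall fun u => SchwartzMap.norm_le_seminorm ℝ φ _), ?_⟩
  simp_rw [hφ]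
  change ‖∫ u, h u • 𝓕 g u‖ ≤ _
  rw [← integral_fourier_smul_eq_of_integrable hh hg]
  refine (norm_integral_le_of_norm_le (hg.norm.const_mul M) (Eventually.of_forall fun ξ => ?_)).trans
    ?_
  · rw [norm_smul]
    gcongr
    exact hfh ξ
  · rw [integral_const_mul, hgint]
    linarith

lemma log_smul_log_smul_mertensErrorInv_exp {u : ℝ} (hu : 0 ≤ u) :
    Real.log (Real.exp (-u)) • Real.log (Real.exp (-u)) • mertensErrorInv (Real.exp (-u)) =
      ((u ^ 2 * mertensError (Real.exp u) : ℝ) : ℂ) := by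
  rw [mertensErrorInv_eq (Real.exp_pos _) (by simpa using hu), ← Real.exp_neg, neg_neg,
    Real.log_exp, real_smul, real_smul]
  push_cast
  ring

lemma exists_abs_integral_mertensError_le {φ : ℝ → ℝ} (hφ : HasCompactSupport φ)
    (hφ' : ContDiff ℝ ∞ φ) (hsupp : ∀ w, φ w ≠ 0 → |w| ≤ 2) :
    ∃ C > 0, ∀ v : ℝ, 2 ≤ v →
      Integrable (fun u => Real.exp (-v⁻¹ * u) * (u ^ 2 * mertensError (Real.exp u)) *
        φ (v * (u - v))) ∧
      |∫ u, Real.exp (-v⁻¹ * u) * (u ^ 2 * mertensError (Real.exp u)) * φ (v * (u - v))| ≤ C := by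
  obtain ⟨Φ, hΦ⟩ : ∃ Φ : 𝓢(ℝ, ℂ), ∀ w, Φ w = φ w :=
    ⟨(hφ.comp_left (g := ofRealCLM) (map_zero _)).toSchwartzMap (ofRealCLM.contDiff.comp hφ'),
      fun _ => rfl⟩
  obtain ⟨C, hC, h⟩ := exists_norm_integral_mertensErrorInv_le Φ
  refine ⟨C, hC, fun v hv => ?_⟩
  obtain ⟨h1, h2⟩ := h v (by linarith)
  have key : ∀ u, (Real.exp (-v⁻¹ * u) • (Real.log (Real.exp (-u)) •
        Real.log (Real.exp (-u)) • mertensErrorInv (Real.exp (-u)))) •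
        Φ (v * (u - v)) =
        ((Real.exp (-v⁻¹ * u) * (u ^ 2 * mertensError (Real.exp u)) * φ (v * (u - v)) : ℝ) : ℂ) := by
    intro u
    rw [hΦ]
    by_cases h0 : φ (v * (u - v)) = 0
    · simp [h0]
    have hu : 0 ≤ u := by
      have := (abs_le.1 (hsupp _ h0)).1
      nlinarith
    rw [log_smul_log_smul_mertensErrorInv_exp hu, real_smul, smul_eq_mul]
    push_cast
    ring
  simp_rw [key] at h1 h2
  rw [integral_complex_ofReal, norm_real] at h2
  exact ⟨h1.re, h2⟩

lemma exists_forall_le_div_of_le_mul_mertensError {φ : ℝ → ℝ} (hφ : HasCompactSupport φ)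
    (hφ' : ContDiff ℝ ∞ φ) (hsupp : ∀ w, φ w ≠ 0 → |w| ≤ 2) (hnonneg : ∀ w, 0 ≤ φ w)
    (hpos : 0 < ∫ w, φ w) :
    ∃ C > 0, ∀ v : ℝ, 2 ≤ v → ∀ a ε : ℝ, |ε| = 1 →
      (∀ u, φ (v * (u - v)) ≠ 0 → a ≤ ε * mertensError (Real.exp u)) → a ≤ C / v := by
  obtain ⟨C, hC, h⟩ := exists_abs_integral_mertensError_le hφ hφ' hsupp
  set J := ∫ w, φ w
  refine ⟨C / (Real.exp (-2) / 4 * J), by positivity, fun v hv a ε hε ha => ?_⟩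
  have hv0 : 0 < v := by linarith
  rcases le_or_gt a 0 with ha0 | ha0
  · exact ha0.trans (by positivity)
  obtain ⟨hint, hle⟩ := h v hv
  have hJ : ∫ u, φ (v * (u - v)) = v⁻¹ * J := by
    rw [integral_sub_right_eq_self (fun u => φ (v * u)), Measure.integral_comp_mul_left,
      abs_of_pos (by positivity), smul_eq_mul]
  have hφint : Integrable (fun u => φ (v * (u - v))) :=
    ((hφ'.continuous.integrable_of_hasCompactSupport hφ).comp_mul_left' hv0.ne').comp_sub_right v
  have hmono : Real.exp (-2) / 4 * v ^ 2 * a * (v⁻¹ * J) ≤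
      ε * ∫ u, Real.exp (-v⁻¹ * u) * (u ^ 2 * mertensError (Real.exp u)) * φ (v * (u - v)) := by
    rw [← hJ, ← integral_const_mul, ← integral_const_mul]
    refine integral_mono (hφint.const_mul _) (hint.const_mul _) fun u => ?_
    by_cases h0 : φ (v * (u - v)) = 0
    · simp [h0]
    have hu := abs_le.1 (hsupp _ h0)
    have hu1 : v / 2 ≤ u := by nlinarith
    have hu2 : v⁻¹ * u ≤ 2 := by
      rw [inv_mul_le_iff₀ hv0]; nlinarith
    have hau := ha u h0
    calc Real.exp (-2) / 4 * v ^ 2 * a * φ (v * (u - v))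
        = Real.exp (-2) * ((v / 2) ^ 2 * a) * φ (v * (u - v)) := by ring
      _ ≤ Real.exp (-v⁻¹ * u) * (u ^ 2 * (ε * mertensError (Real.exp u))) * φ (v * (u - v)) := by
          have := hnonneg (v * (u - v))
          gcongr
          linarith
      _ = _ := by ring
  have h3 : Real.exp (-2) / 4 * v ^ 2 * a * (v⁻¹ * J) ≤ C := by
    refine hmono.trans ((le_abs_self _).trans ?_)
    rwa [abs_mul, hε, one_mul]
  rw [div_div, le_div_iff₀ (by positivity)]
  refine le_of_eq_of_le ?_ h3
  field_simp

lemma exists_abs_mertensError_exp_le :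
    ∃ C > 0, ∀ v : ℝ, 2 ≤ v → |mertensError (Real.exp v)| ≤ C / v := by
  have main : ∀ c : ℝ, |c| = 1 → ∃ C > 0, ∀ v : ℝ, 2 ≤ v → ∀ a ε : ℝ, |ε| = 1 →
      (∀ u, |v * (u - v) - c| < 1 → a ≤ ε * mertensError (Real.exp u)) → a ≤ C / v := by
    intro c hc
    let φ : ContDiffBump c := ⟨1 / 2, 1, by norm_num, by norm_num⟩
    have hs : ∀ w, φ w ≠ 0 → |w - c| < 1 := fun w hw => by
      have : w ∈ Function.support φ := hw
      rwa [φ.support_eq, Metric.mem_ball, Real.dist_eq] at this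
    have hs2 : ∀ w, φ w ≠ 0 → |w| ≤ 2 := fun w hw => by
      have := abs_add_le (w - c) c
      rw [sub_add_cancel] at this
      linarith [hs w hw]
    obtain ⟨C, hC, h⟩ := exists_forall_le_div_of_le_mul_mertensError φ.hasCompactSupport
      φ.contDiff hs2 (fun w => φ.nonneg) φ.integral_pos
    exact ⟨C, hC, fun v hv a ε hε ha => h v hv a ε hε fun u hu => ha u (hs _ hu)⟩
  obtain ⟨C₁, hC₁, h₁⟩ := main 1 (by simp)
  obtain ⟨C₂, hC₂, h₂⟩ := main (-1) (by simp)
  refine ⟨max C₁ C₂ + 2, by positivity, fun v hv => ?_⟩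
  have hv0 : 0 < v := by linarith
  have e1 := h₁ v hv (mertensError (Real.exp v) - 2 / v) 1 (by simp) fun u hu => ?_
  · have e2 := h₂ v hv (-mertensError (Real.exp v) - 2 / v) (-1) (by simp) fun u hu => ?_
    · have : C₁ / v ≤ max C₁ C₂ / v := by gcongr; exact le_max_left _ _
      have : C₂ / v ≤ max C₁ C₂ / v := by gcongr; exact le_max_right _ _
      rw [add_div, abs_le]
      constructor <;> linarith
    · rw [abs_lt] at hu
      have hu1 : u ≤ v := by nlinarith
      have hu2 : v - u ≤ 2 / v := by rw [le_div_iff₀ hv0]; linarith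
      have := monotone_vonMangoldtSum (Real.exp_le_exp.2 hu1)
      simp only [mertensError, Real.log_exp]
      linarith
  · rw [abs_lt] at hu
    have hu1 : v ≤ u := by nlinarith
    have hu2 : u - v ≤ 2 / v := by rw [le_div_iff₀ hv0]; linarith
    have := monotone_vonMangoldtSum (Real.exp_le_exp.2 hu1)
    simp only [mertensError, Real.log_exp]
    linarith

end

section

open Complex Filter Topology Asymptotics MeasureTheory Set

lemma sum_vonMangoldt_mul_eq_sum_primesLE (n : ℕ) (f : ℕ → ℝ) :
    ∑ m ∈ Finset.Icc 1 n, ArithmeticFunction.vonMangoldt m * f m =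
      ∑ p ∈ n.primesLE, Real.log p * ∑ k ∈ Finset.Icc 1 (p.log n), f (p ^ k) := calc
  _ = ∑ m ∈ ((Finset.Icc 1 n).filter Nat.Prime).biUnion
        fun p => (Finset.Icc 1 (p.log n)).image (p ^ ·), ArithmeticFunction.vonMangoldt m * f m := by
    refine (Finset.sum_subset (fun q hq => ?_) fun x hx => ?_).symm
    · simp only [Finset.mem_biUnion, Finset.mem_filter, Finset.mem_Icc, Finset.mem_image] at hq ⊢
      obtain ⟨p, ⟨⟨_, hp⟩, hp'⟩, k, ⟨_, hk⟩, rfl⟩ := hq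
      exact ⟨Nat.one_le_pow _ _ hp'.pos, Nat.pow_le_of_le_log (by lia) hk⟩
    · simp only [Finset.mem_biUnion, Finset.mem_filter, Finset.mem_Icc, Finset.mem_image,
        not_exists, not_and, and_imp, mul_eq_zero]
      intro h
      left
      revert h
      simp only [ArithmeticFunction.vonMangoldt_eq_zero_iff, isPrimePow_nat_iff]
      contrapose!
      rintro ⟨p, k, hp, hk, rfl⟩
      simp only [Finset.mem_Icc] at hx
      have hpn : p ≤ n := (Nat.le_of_dvd (by lia) (dvd_pow_self p hk.ne')).trans hx.2
      exact ⟨p, hp.one_le, hpn, hp, k, by lia, Nat.le_log_of_pow_le hp.one_lt hx.2, rfl⟩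
  _ = ∑ p ∈ Finset.Icc 1 n with p.Prime, ∑ q ∈ (Finset.Icc 1 (p.log n)).image (fun k => p ^ k),
        ArithmeticFunction.vonMangoldt q * f q := by
    rw [Finset.sum_biUnion <| by rw [Finset.pairwiseDisjoint_iff]; grind [Nat.Prime.pow_inj']]
  _ = ∑ p ∈ n.primesLE, ∑ k ∈ Finset.Icc 1 (p.log n),
        ArithmeticFunction.vonMangoldt (p ^ k) * f (p ^ k) := by
    refine Finset.sum_congr (Nat.primesLE_eq_filter_Icc_one n).symm fun p hp => ?_
    exact Finset.sum_image fun a _ b _ hab =>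
      Nat.pow_right_injective (Nat.two_le_of_mem_primesLE hp) hab
  _ = _ := by
    refine Finset.sum_congr rfl fun p hp => ?_
    rw [Finset.mul_sum]
    refine Finset.sum_congr rfl fun k hk => ?_
    rw [ArithmeticFunction.vonMangoldt_apply_pow (by grind),
      ArithmeticFunction.vonMangoldt_apply_prime <| Nat.prime_of_mem_primesLE hp]

lemma sum_Icc_inv_pow {x : ℝ} (hx : 1 < x) (K : ℕ) :
    ∑ k ∈ Finset.Icc 1 K, (x ^ k)⁻¹ = 1 / (x - 1) - 1 / ((x - 1) * x ^ K) := by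
  have h1 : x - 1 ≠ 0 := by linarith
  have h0 : x ≠ 0 := by linarith
  induction K with
  | zero => simp
  | succ K ih =>
    rw [Finset.sum_Icc_succ_top (by lia), ih]
    field_simp
    ring

lemma log_div_sub_one_mul_pow_log_le {n p : ℕ} (hp : p.Prime) (hpn : p ≤ n) :
    Real.log p / (((p : ℝ) - 1) * (p : ℝ) ^ p.log n) ≤
      8 * (n : ℝ) ^ (-(1 / 4) : ℝ) * (p : ℝ) ^ (-(5 / 4) : ℝ) := by
  have hp2 : (2 : ℝ) ≤ p := by exact_mod_cast hp.two_le
  have hp0 : (0 : ℝ) < p := by linarith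
  have hn0 : (0 : ℝ) < n := by exact_mod_cast hp.pos.trans_le hpn
  have hK : 1 ≤ p.log n := Nat.log_pos hp.one_lt hpn
  have hP0 : (0 : ℝ) < (p : ℝ) ^ p.log n := by positivity
  have h1 : (p : ℝ) ≤ (p : ℝ) ^ p.log n := le_self_pow₀ (by linarith) (by lia)
  have h2 : (n : ℝ) ≤ ((p : ℝ) ^ p.log n) ^ 2 := by
    rw [← pow_mul]
    have := (Nat.lt_pow_succ_log_self hp.one_lt n).le.trans
      (Nat.pow_le_pow_right hp.pos (show (p.log n).succ ≤ p.log n * 2 by lia))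
    exact_mod_cast this
  have h3 : (p : ℝ) ^ (1 / 2 : ℝ) * (n : ℝ) ^ (1 / 4 : ℝ) ≤ (p : ℝ) ^ p.log n := by
    calc (p : ℝ) ^ (1 / 2 : ℝ) * (n : ℝ) ^ (1 / 4 : ℝ)
        ≤ ((p : ℝ) ^ p.log n) ^ (1 / 2 : ℝ) * (((p : ℝ) ^ p.log n) ^ 2) ^ (1 / 4 : ℝ) := by gcongr
      _ = (p : ℝ) ^ p.log n := by
        rw [← Real.rpow_natCast ((p : ℝ) ^ p.log n) 2, ← Real.rpow_mul hP0.le,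
          ← Real.rpow_add hP0]
        norm_num
  have h4 : Real.log p ≤ 4 * (p : ℝ) ^ (1 / 4 : ℝ) := by
    have := Real.log_le_rpow_div hp0.le (show (0 : ℝ) < 1 / 4 by norm_num)
    linarith
  calc Real.log p / (((p : ℝ) - 1) * (p : ℝ) ^ p.log n)
      ≤ 4 * (p : ℝ) ^ (1 / 4 : ℝ) / ((p : ℝ) / 2 * ((p : ℝ) ^ (1 / 2 : ℝ) * (n : ℝ) ^ (1 / 4 : ℝ))) := by
        have : (p : ℝ) / 2 ≤ p - 1 := by linarith
        have : 0 < (p : ℝ) - 1 := by linarith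
        gcongr
    _ = 8 * (n : ℝ) ^ (-(1 / 4) : ℝ) * (p : ℝ) ^ (-(5 / 4) : ℝ) := by
        have e : (p : ℝ) ^ (5 / 4 : ℝ) * (p : ℝ) ^ (1 / 4 : ℝ) = p * (p : ℝ) ^ (1 / 2 : ℝ) := by
          conv_rhs => rw [← Real.rpow_one p, ← Real.rpow_mul hp0.le]
          rw [← Real.rpow_add hp0, ← Real.rpow_add hp0]
          norm_num
        rw [Real.rpow_neg hn0.le, Real.rpow_neg hp0.le]
        field_simp
        linear_combination 8 * e

lemma exists_abs_sum_log_div_sub_one_sub_vonMangoldtSum_le :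
    ∃ C > 0, ∀ n : ℕ, 2 ≤ n →
      |∑ p ∈ n.primesLE, Real.log p / ((p : ℝ) - 1) - vonMangoldtSum n| ≤ C / Real.log n := by
  have hsum : Summable fun m : ℕ => (m : ℝ) ^ (-(5 / 4) : ℝ) :=
    Real.summable_nat_rpow.2 (by norm_num)
  refine ⟨32 * (∑' m : ℕ, (m : ℝ) ^ (-(5 / 4) : ℝ)) + 1, by positivity, fun n hn => ?_⟩
  have hn0 : (0 : ℝ) < n := by positivity
  have hlog : 0 < Real.log n := Real.log_pos (by exact_mod_cast hn)
  have hdiff : ∑ p ∈ n.primesLE, Real.log p / ((p : ℝ) - 1) - vonMangoldtSum n =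
      ∑ p ∈ n.primesLE, Real.log p / (((p : ℝ) - 1) * (p : ℝ) ^ p.log n) := by
    have := sum_vonMangoldt_mul_eq_sum_primesLE n fun m => (m : ℝ)⁻¹
    simp only [vonMangoldtSum, Nat.floor_natCast, div_eq_mul_inv]
    rw [this, ← Finset.sum_sub_distrib]
    refine Finset.sum_congr rfl fun p hp => ?_
    have hp1 : (1 : ℝ) < p := by exact_mod_cast (Nat.prime_of_mem_primesLE hp).one_lt
    push_cast
    rw [sum_Icc_inv_pow hp1]
    ring
  have hnn : ∀ p ∈ n.primesLE, 0 ≤ Real.log p / (((p : ℝ) - 1) * (p : ℝ) ^ p.log n) := by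
    intro p hp
    have hp1 : (1 : ℝ) < p := by exact_mod_cast (Nat.prime_of_mem_primesLE hp).one_lt
    have := Real.log_nonneg hp1.le
    have : 0 < (p : ℝ) - 1 := by linarith
    positivity
  rw [hdiff, abs_of_nonneg (Finset.sum_nonneg hnn), le_div_iff₀ hlog]
  have h1 : ∑ p ∈ n.primesLE, Real.log p / (((p : ℝ) - 1) * (p : ℝ) ^ p.log n) ≤
      8 * (n : ℝ) ^ (-(1 / 4) : ℝ) * ∑' m : ℕ, (m : ℝ) ^ (-(5 / 4) : ℝ) := by
    refine (Finset.sum_le_sum fun p hp => log_div_sub_one_mul_pow_log_le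
      (Nat.prime_of_mem_primesLE hp) (Nat.le_of_mem_primesLE hp)).trans ?_
    rw [← Finset.mul_sum]
    gcongr
    exact hsum.sum_le_tsum _ fun _ _ => by positivity
  have h2 : (n : ℝ) ^ (-(1 / 4) : ℝ) * Real.log n ≤ 4 := by
    have := Real.log_le_rpow_div hn0.le (show (0 : ℝ) < 1 / 4 by norm_num)
    rw [Real.rpow_neg hn0.le, inv_mul_le_iff₀ (by positivity)]
    linarith
  have hT : 0 ≤ ∑' m : ℕ, (m : ℝ) ^ (-(5 / 4) : ℝ) := tsum_nonneg fun _ => by positivity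
  nlinarith [mul_le_mul_of_nonneg_right h1 hlog.le]

end

/-- There exists `C > 0` such that for all `n ≥ 2`,
`|Σ_{2 < p ≤ 2n} log p/(p−1) − log n + γ| ≤ C/log n`. -/
theorem mertens_type_estimate :
    ∃ C > 0, ∀ n : ℕ, 2 ≤ n →
      |(∑ p ∈ (Finset.range (2 * n + 1)).filter (fun p => p.Prime ∧ 2 < p),
          Real.log p / ((p : ℝ) - 1))
        - Real.log n + Real.eulerMascheroniConstant| ≤ C / Real.log n := by
  obtain ⟨C₁, hC₁, h₁⟩ := exists_abs_mertensError_exp_le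
  obtain ⟨C₂, hC₂, h₂⟩ := exists_abs_sum_log_div_sub_one_sub_vonMangoldtSum_le
  set B := ∑ n ∈ Finset.range 4, |mertensError (2 * n : ℕ)| * Real.log (2 * n : ℕ) with hB
  have hB0 : 0 ≤ B := Finset.sum_nonneg fun n _ =>
    mul_nonneg (abs_nonneg _) (Real.log_natCast_nonneg _)
  have hE : ∀ n : ℕ, 2 ≤ n → |mertensError (2 * n : ℕ)| ≤ (C₁ + B) / Real.log (2 * n : ℕ) := by
    intro n hn
    have hlog : 0 < Real.log (2 * n : ℕ) := Real.log_pos (by exact_mod_cast (by lia : 1 < 2 * n))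
    rw [le_div_iff₀ hlog]
    rcases lt_or_ge n 4 with h4 | h4
    · have := Finset.single_le_sum (f := fun n : ℕ => |mertensError (2 * n : ℕ)| *
        Real.log (2 * n : ℕ)) (fun n _ => mul_nonneg (abs_nonneg _) (Real.log_natCast_nonneg _))
        (Finset.mem_range.2 h4)
      linarith
    · have h2 : 2 ≤ Real.log (2 * n : ℕ) := by
        rw [Real.le_log_iff_exp_le (by positivity)]
        have h8 : (8 : ℝ) ≤ (2 * n : ℕ) := by exact_mod_cast (by lia : 8 ≤ 2 * n)
        have := Real.exp_one_lt_d9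
        have e : Real.exp 2 = Real.exp 1 ^ 2 := by rw [← Real.exp_nat_mul]; norm_num
        have := Real.exp_pos 1
        nlinarith
      have := h₁ _ h2
      rw [Real.exp_log (by positivity), le_div_iff₀ hlog] at this
      linarith
  refine ⟨C₁ + B + C₂, by positivity, fun n hn => ?_⟩
  have hn0 : (0 : ℝ) < n := by positivity
  have hlogn : 0 < Real.log n := Real.log_pos (by exact_mod_cast hn)
  have hlog2n : Real.log (2 * n : ℕ) = Real.log 2 + Real.log n := by
    push_cast
    exact Real.log_mul (by norm_num) hn0.ne'
  have hlogle : Real.log n ≤ Real.log (2 * n : ℕ) := by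
    linarith [Real.log_pos one_lt_two]
  have hsum : ∑ p ∈ (2 * n).primesLE, Real.log p / ((p : ℝ) - 1) =
      Real.log 2 + ∑ p ∈ (Finset.range (2 * n + 1)).filter (fun p => p.Prime ∧ 2 < p),
        Real.log p / ((p : ℝ) - 1) := by
    have : (2 * n).primesLE =
        insert 2 ((Finset.range (2 * n + 1)).filter (fun p => p.Prime ∧ 2 < p)) := by
      ext p
      simp only [Nat.mem_primesLE, Finset.mem_insert, Finset.mem_filter, Finset.mem_range]
      constructor
      · rintro ⟨h1, h2⟩
        have := h2.two_le
        grind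
      · rintro (rfl | h)
        · exact ⟨by lia, Nat.prime_two⟩
        · grind
    rw [this, Finset.sum_insert (by simp)]
    norm_num
  have e1 := hE n hn
  have e2 := h₂ (2 * n) (by lia)
  rw [hsum] at e2
  have key : (∑ p ∈ (Finset.range (2 * n + 1)).filter (fun p => p.Prime ∧ 2 < p),
          Real.log p / ((p : ℝ) - 1)) - Real.log n + Real.eulerMascheroniConstant =
      mertensError (2 * n : ℕ) + (Real.log 2 +
        ∑ p ∈ (Finset.range (2 * n + 1)).filter (fun p => p.Prime ∧ 2 < p),
          Real.log p / ((p : ℝ) - 1) - vonMangoldtSum (2 * n : ℕ)) := by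
    rw [mertensError, hlog2n]
    ring
  rw [key]
  calc _ ≤ _ := abs_add_le _ _
    _ ≤ (C₁ + B) / Real.log (2 * n : ℕ) + C₂ / Real.log (2 * n : ℕ) := add_le_add e1 e2
    _ = (C₁ + B + C₂) / Real.log (2 * n : ℕ) := by ring
    _ ≤ _ := by gcongr
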